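/- arXiv:1909.09127 — 6 statements merged into one kernel-verified Lean document; each statement's English description precedes it below -/
import Mathlib

section
/- Let d = 24 and let r be a symmetric function on chains in B̄ (its value on a chain depends only on the sequence of cardinalities) such that ∑_{S_•} r(S_•)·x_{S_•} ≡ Td_24 modulo I_1 + I_2. Then for every 4-chain S_1 ⊊ S_2 ⊊ S_3 ⊊ S_4 of subsets of {1,…,25} with |S_1| = 10, |S_2| = 12, |S_3| = 13, |S_4| = 15, one has r(S_1,S_2,S_3,S_4) = −19/1684800. In particular, this value is negative, disproving the conjecture that the Berline–Vergne function is positive on all cones of braid fans. -/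
open MvPolynomial

/-- Subsets of the ground set `{1, …, d+1}` (modeled as `Fin (d+1)`). -/
abbrev Subs (d : ℕ) := Finset (Fin (d + 1))

/-- The polynomial ring `R_d` with one variable `x_S` for each subset `S`
(only the variables indexed by proper nonempty subsets are ever used). -/
abbrev Rd (d : ℕ) := MvPolynomial (Subs d) ℚ

/-- `S ∈ B̄`, i.e. `S ≠ ∅` and `S ≠ {1,…,d+1}`. -/
def isProper (d : ℕ) (S : Subs d) : Prop := S ≠ ∅ ∧ S ≠ Finset.univ

instance (d : ℕ) (S : Subs d) : Decidable (isProper d S) := by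
  unfold isProper; infer_instance

/-- The ideal `I₁` generated by products of variables indexed by incomparable
members of `B̄`. -/
noncomputable def I1 (d : ℕ) : Ideal (Rd d) :=
  Ideal.span {p | ∃ S S' : Subs d, isProper d S ∧ isProper d S' ∧
    ¬ S ⊆ S' ∧ ¬ S' ⊆ S ∧ p = X S * X S'}

/-- `ℓ_a = ∑_{S ∈ B̄, a ∈ S} x_S`. -/
noncomputable def ell (d : ℕ) (a : Fin (d + 1)) : Rd d :=
  ∑ S ∈ Finset.univ.filter (fun S : Subs d => isProper d S ∧ a ∈ S), X S

/-- The ideal `I₂` generated by the differences `ℓ_a - ℓ_b`. -/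
noncomputable def I2 (d : ℕ) : Ideal (Rd d) :=
  Ideal.span {p | ∃ a b : Fin (d + 1), p = ell d a - ell d b}

/-- The ideal `I₁ + I₂`; the Chow ring of the permutohedral variety is
`A_d = R_d/(I₁+I₂)`, and an identity holds "in `A_d`" iff the difference of
the two sides lies in `Itot d`. -/
noncomputable def Itot (d : ℕ) : Ideal (Rd d) := I1 d + I2 d

/-- `τ_m = B'_m/m!`, the coefficients of `x/(1-e^{-x})` (with `B'₁ = +1/2`). -/
noncomputable def tau (m : ℕ) : ℚ := bernoulli' m / m.factorial

/-- The Todd polynomial `Td_d = ∏_{S ∈ B̄} (∑_{m=0}^{d} τ_m x_S^m)`. -/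
noncomputable def Td (d : ℕ) : Rd d :=
  ∏ S ∈ Finset.univ.filter (fun S : Subs d => isProper d S),
    ∑ m ∈ Finset.range (d + 1), C (tau m) * X S ^ m

/-- A finite set of subsets is a (proper) chain in `B̄` if all its members are
proper and any two of its members are comparable. -/
def IsProperChain (d : ℕ) (H : Finset (Subs d)) : Prop :=
  (∀ T ∈ H, isProper d T) ∧ ∀ T ∈ H, ∀ T' ∈ H, T ⊆ T' ∨ T' ⊆ T

instance (d : ℕ) (H : Finset (Subs d)) : Decidable (IsProperChain d H) := by
  unfold IsProperChain; infer_instance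

/-- The square-free monomial `x_{S_•} = ∏_{T ∈ S_•} x_T` of a chain. -/
noncomputable def chainMon (d : ℕ) (H : Finset (Subs d)) : Rd d := ∏ T ∈ H, X T

def tabL : List ((ℕ × ℕ × ℕ × ℕ) × ℤ) :=
  [((0, 0, 0, 4), -208),
   ((0, 0, 3, 1), 1200),
   ((0, 0, 4, 0), -3000),
   ((0, 2, 0, 2), 650),
   ((0, 2, 1, 1), -1950),
   ((0, 2, 2, 0), 1625),
   ((0, 3, 0, 1), 2600),
   ((0, 4, 0, 0), -3000),
   ((1, 0, 0, 3), 312),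
   ((1, 0, 2, 1), -1560),
   ((1, 0, 3, 0), 2600),
   ((1, 1, 0, 2), -780),
   ((1, 1, 1, 1), 2340),
   ((1, 1, 2, 0), -1950),
   ((1, 2, 0, 1), -1560),
   ((1, 3, 0, 0), 1200),
   ((2, 0, 0, 2), 468),
   ((2, 0, 1, 1), -780),
   ((2, 0, 2, 0), 650),
   ((3, 0, 0, 1), 312),
   ((4, 0, 0, 0), -208)]

def tabZ (a b c d : ℕ) : ℤ :=
  if a + b + c + d = 4 then (List.lookup (a, b, c, d) tabL).getD 0 else 0

lemma tabZ_ne (a b c d : ℕ) (h : a + b + c + d ≠ 4) : tabZ a b c d = 0 := if_neg h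

lemma tab_rel_fin : ∀ a b c d : Fin 4, (a : ℕ) + b + c + d = 3 →
    ∀ s ∈ [(10, (a : ℕ)), (12, (b : ℕ)), (13, (c : ℕ)), (15, (d : ℕ))], 1 ≤ s.2 →
    25 * (tabZ (a+1) b c d * (min 10 s.1 : ℕ) + tabZ a (b+1) c d * (min 12 s.1 : ℕ)
      + tabZ a b (c+1) d * (min 13 s.1 : ℕ) + tabZ a b c (d+1) * (min 15 s.1 : ℕ))
    = (s.1 : ℤ) * (tabZ (a+1) b c d * 10 + tabZ a (b+1) c d * 12
      + tabZ a b (c+1) d * 13 + tabZ a b c (d+1) * 15) := by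
  decide +kernel

lemma tab_rel (a b c d : ℕ) (s : ℕ × ℕ)
    (hs : s ∈ [(10, a), (12, b), (13, c), (15, d)]) (h1 : 1 ≤ s.2) :
    25 * (tabZ (a+1) b c d * (min 10 s.1 : ℕ) + tabZ a (b+1) c d * (min 12 s.1 : ℕ)
      + tabZ a b (c+1) d * (min 13 s.1 : ℕ) + tabZ a b c (d+1) * (min 15 s.1 : ℕ))
    = (s.1 : ℤ) * (tabZ (a+1) b c d * 10 + tabZ a (b+1) c d * 12
      + tabZ a b (c+1) d * 13 + tabZ a b c (d+1) * 15) := by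
  by_cases h : a + b + c + d = 3
  · exact tab_rel_fin ⟨a, by omega⟩ ⟨b, by omega⟩ ⟨c, by omega⟩ ⟨d, by omega⟩ h s hs h1
  · rw [tabZ_ne, tabZ_ne, tabZ_ne, tabZ_ne] <;> omega

def tabE (e : ℕ →₀ ℕ) : ℚ := (tabZ (e 10) (e 12) (e 13) (e 15) : ℚ)

noncomputable def Phi : MvPolynomial ℕ ℚ →ₗ[ℚ] ℚ :=
  (MvPolynomial.basisMonomials ℕ ℚ).constr ℚ tabE

lemma Phi_mono (e : ℕ →₀ ℕ) (c : ℚ) : Phi (monomial e c) = c * tabE e := by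
  have h : monomial e c = c • (MvPolynomial.basisMonomials ℕ ℚ e) := by
    simp [MvPolynomial.smul_monomial]
  rw [h, map_smul, Phi, Module.Basis.constr_basis, smul_eq_mul]

def AA : Finset ℕ := {10, 12, 13, 15}

lemma sumAA {M : Type*} [AddCommMonoid M] (f : ℕ → M) :
    ∑ k ∈ AA, f k = f 10 + f 12 + f 13 + f 15 := by
  simp [AA, add_assoc]

lemma prodAA {M : Type*} [CommMonoid M] (f : ℕ → M) :
    ∏ k ∈ AA, f k = f 10 * f 12 * f 13 * f 15 := by
  simp [AA, mul_assoc]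

/-- weights: `w_k = Φ(t^e t_k)` -/
noncomputable def ww (e : ℕ →₀ ℕ) (k : ℕ) : ℚ := tabE (e + Finsupp.single k 1)

lemma ww_rel (e : ℕ →₀ ℕ) (s : ℕ) (hs : s = 0 ∨ s = 25 ∨ (s ∈ AA ∧ 1 ≤ e s)) :
    25 * ∑ k ∈ AA, ww e k * (min k s : ℕ) = s * ∑ k ∈ AA, ww e k * k := by
  rcases hs with rfl | rfl | ⟨hs, h1⟩
  · simp
  · norm_num [AA]
  · have key : ∀ x ∈ [(10, e 10), (12, e 12), (13, e 13), (15, e 15)], 1 ≤ x.2 → 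
      (25 : ℚ) * ∑ k ∈ AA, ww e k * (min k x.1 : ℕ) = x.1 * ∑ k ∈ AA, ww e k * k := by
      intro x hx hx1
      have h := tab_rel (e 10) (e 12) (e 13) (e 15) x hx hx1
      have h' := congrArg (fun z : ℤ => (z : ℚ)) h
      push_cast at h'
      simp only [sumAA, ww, tabE, Finsupp.add_apply, Finsupp.single_apply]
      norm_num
      linarith
    have : (s, e s) ∈ [(10, e 10), (12, e 12), (13, e 13), (15, e 15)] := by
      simp only [AA, Finset.mem_insert, Finset.mem_singleton] at hs
      rcases hs with rfl | rfl | rfl | rfl <;> simp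
    exact key _ this h1

def Fl (σ : Equiv.Perm (Fin 25)) (k : ℕ) : Finset (Fin 25) :=
  Finset.univ.filter (fun a => (σ a : ℕ) < k)

lemma mem_Fl (σ : Equiv.Perm (Fin 25)) (k : ℕ) (a : Fin 25) : a ∈ Fl σ k ↔ (σ a : ℕ) < k := by
  simp [Fl]

lemma card_range (σ : Equiv.Perm (Fin 25)) (s u : ℕ) (hu : u ≤ 25) :
    (Finset.univ.filter (fun a => s ≤ (σ a : ℕ) ∧ (σ a : ℕ) < u)).card = u - s := by
  rw [← Nat.card_Ico]
  refine Finset.card_bij (fun a _ => (σ a : ℕ)) ?_ ?_ ?_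
  · intro a ha
    simpa using ha
  · intro a _ b _ h
    exact σ.injective (Fin.ext h)
  · intro b hb
    rw [Finset.mem_Ico] at hb
    exact ⟨σ.symm ⟨b, by omega⟩, by simpa using hb, by simp⟩

lemma card_Fl (σ : Equiv.Perm (Fin 25)) (k : ℕ) (hk : k ≤ 25) : (Fl σ k).card = k := by
  simpa [Fl] using card_range σ 0 k hk

def good (σ : Equiv.Perm (Fin 25)) (T : Subs 24) : Prop := T.card ∈ AA ∧ T = Fl σ T.card

instance (σ : Equiv.Perm (Fin 25)) (T : Subs 24) : Decidable (good σ T) := by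
  unfold good; infer_instance

lemma AA_le {k : ℕ} (hk : k ∈ AA) : 0 < k ∧ k < 25 := by
  simp only [AA, Finset.mem_insert, Finset.mem_singleton] at hk
  omega

lemma good_Fl (σ : Equiv.Perm (Fin 25)) {k : ℕ} (hk : k ∈ AA) : good σ (Fl σ k) := by
  unfold good
  rw [card_Fl σ k (AA_le hk).2.le]
  exact ⟨hk, rfl⟩

lemma Fl_inj (σ : Equiv.Perm (Fin 25)) {k l : ℕ} (hk : k ∈ AA) (hl : l ∈ AA)
    (h : Fl σ k = Fl σ l) : k = l := by
  rw [← card_Fl σ k (AA_le hk).2.le, h, card_Fl σ l (AA_le hl).2.le]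

lemma proper_Fl (σ : Equiv.Perm (Fin 25)) {k : ℕ} (hk : k ∈ AA) : isProper 24 (Fl σ k) := by
  have h := card_Fl σ k (AA_le hk).2.le
  have h' := AA_le hk
  constructor
  · intro h0; rw [h0] at h; simp at h; omega
  · intro h0
    have : (Fl σ k).card = 25 := by rw [h0]; simp
    omega

noncomputable def ev (σ : Equiv.Perm (Fin 25)) : Rd 24 →ₐ[ℚ] MvPolynomial ℕ ℚ :=
  aeval (fun T => if good σ T then X T.card else 0)

lemma ev_X (σ : Equiv.Perm (Fin 25)) (T : Subs 24) :
    ev σ (X T) = if good σ T then X T.card else 0 := by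
  simp [ev]

lemma prod_good {M : Type*} [CommMonoid M] (σ : Equiv.Perm (Fin 25)) (Q : Subs 24 → Prop)
    [DecidablePred Q] (g : Subs 24 → M) (hg : ∀ T, ¬ good σ T → g T = 1) :
    ∏ T ∈ Finset.univ.filter Q, g T = ∏ k ∈ AA, if Q (Fl σ k) then g (Fl σ k) else 1 := by
  rw [← Finset.prod_filter]
  have h2 : ∏ k ∈ AA.filter (fun k => Q (Fl σ k)), g (Fl σ k)
      = ∏ T ∈ (AA.filter (fun k => Q (Fl σ k))).image (Fl σ), g T := by
    rw [Finset.prod_image]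
    intro k hk l hl h
    simp only [Finset.coe_filter, Set.mem_ofPred_eq] at hk hl
    exact Fl_inj σ hk.1 hl.1 h
  rw [h2]
  symm
  apply Finset.prod_subset
  · intro T hT
    simp only [Finset.mem_image, Finset.mem_filter] at hT
    obtain ⟨k, ⟨hk, hq⟩, rfl⟩ := hT
    simpa using hq
  · intro T hT hT'
    apply hg
    intro hgood
    apply hT'
    simp only [Finset.mem_filter, Finset.mem_univ, true_and] at hT
    simp only [Finset.mem_image, Finset.mem_filter]
    exact ⟨T.card, ⟨hgood.1, by rw [← hgood.2]; exact hT⟩, hgood.2.symm⟩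

lemma sum_good {M : Type*} [AddCommMonoid M] (σ : Equiv.Perm (Fin 25)) (Q : Subs 24 → Prop)
    [DecidablePred Q] (g : Subs 24 → M) (hg : ∀ T, ¬ good σ T → g T = 0) :
    ∑ T ∈ Finset.univ.filter Q, g T = ∑ k ∈ AA, if Q (Fl σ k) then g (Fl σ k) else 0 := 
  prod_good (M := Multiplicative M) σ Q g hg

lemma ev_ell (σ : Equiv.Perm (Fin 25)) (a : Fin 25) :
    ev σ (ell 24 a) = ∑ k ∈ AA, if a ∈ Fl σ k then X k else 0 := by
  unfold ell
  rw [map_sum, sum_good σ]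
  · refine Finset.sum_congr rfl fun k hk => ?_
    simp only [proper_Fl σ hk, true_and, ev_X, good_Fl σ hk, if_true, card_Fl σ k (AA_le hk).2.le]
  · intro T hT
    rw [ev_X, if_neg hT]

def Rf (e : Subs 24 →₀ ℕ) : Finset (Equiv.Perm (Fin 25)) :=
  Finset.univ.filter (fun σ => ∀ T ∈ e.support, good σ T)

lemma ev_mono (σ : Equiv.Perm (Fin 25)) (e : Subs 24 →₀ ℕ) :
    ev σ (monomial e 1) = if σ ∈ Rf e then monomial (e.mapDomain Finset.card) 1 else 0 := by
  rw [ev, aeval_monomial, map_one, one_mul]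
  split_ifs with h
  · simp only [Rf, Finset.mem_filter, Finset.mem_univ, true_and] at h
    rw [Finsupp.mapDomain, Finsupp.sum, monomial_sum_one, Finsupp.prod]
    refine Finset.prod_congr rfl fun T hT => ?_
    rw [if_pos (h T hT), X_pow_eq_monomial]
  · simp only [Rf, Finset.mem_filter, Finset.mem_univ, true_and] at h
    push Not at h
    obtain ⟨T, hT, hg⟩ := h
    rw [Finsupp.prod]
    apply Finset.prod_eq_zero hT
    rw [if_neg hg, zero_pow (by simpa using hT)]

noncomputable def cnt (e : Subs 24 →₀ ℕ) (k : ℕ) (a : Fin 25) : ℕ :=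
  ((Rf e).filter (fun σ => a ∈ Fl σ k)).card

lemma phi_ell (e : Subs 24 →₀ ℕ) (a : Fin 25) :
    ∑ σ : Equiv.Perm (Fin 25), Phi (ev σ (monomial e 1 * ell 24 a))
      = ∑ k ∈ AA, ww (e.mapDomain Finset.card) k * cnt e k a := by
  have h1 : ∀ σ : Equiv.Perm (Fin 25), Phi (ev σ (monomial e 1 * ell 24 a))
      = ∑ k ∈ AA, if σ ∈ Rf e ∧ a ∈ Fl σ k then ww (e.mapDomain Finset.card) k else 0 := by
    intro σ
    rw [map_mul, ev_mono, ev_ell, Finset.mul_sum, map_sum]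
    refine Finset.sum_congr rfl fun k _ => ?_
    by_cases h : σ ∈ Rf e <;> by_cases h' : a ∈ Fl σ k <;> simp [h, h']
    rw [X, monomial_mul, Phi_mono, ww]
    simp
  rw [Finset.sum_congr rfl fun σ _ => h1 σ, Finset.sum_comm]
  refine Finset.sum_congr rfl fun k _ => ?_
  rw [← Finset.sum_filter, Finset.sum_const, nsmul_eq_mul, mul_comm, cnt]
  congr 3
  ext σ
  simp

lemma cnt_swap (e : Subs 24 →₀ ℕ) (k : ℕ) (a b : Fin 25)
    (hab : ∀ T ∈ e.support, a ∈ T ↔ b ∈ T) : cnt e k a = cnt e k b := by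
  have key : ∀ σ : Equiv.Perm (Fin 25), σ ∈ Rf e → σ * Equiv.swap a b ∈ Rf e := by
    intro σ h
    simp only [Rf, Finset.mem_filter, Finset.mem_univ, true_and] at h ⊢
    intro T hT
    refine ⟨(h T hT).1, ?_⟩
    have h2 := (h T hT).2
    have h3 : ∀ x, x ∈ T ↔ (σ x : ℕ) < T.card := by
      intro x
      rw [← mem_Fl, ← h2]
    ext x
    rw [mem_Fl, Equiv.Perm.mul_apply, ← h3]
    by_cases hxa : x = a
    · subst hxa; rw [Equiv.swap_apply_left]; exact hab T hT
    by_cases hxb : x = b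
    · subst hxb; rw [Equiv.swap_apply_right]; exact (hab T hT).symm
    rw [Equiv.swap_apply_of_ne_of_ne hxa hxb]
  unfold cnt
  refine Finset.card_bij' (fun σ _ => σ * Equiv.swap a b) (fun σ _ => σ * Equiv.swap a b) ?_ ?_ ?_ ?_
  · intro σ hσ
    rw [Finset.mem_filter] at hσ ⊢
    refine ⟨key σ hσ.1, ?_⟩
    have := hσ.2
    rw [mem_Fl] at this ⊢
    simpa using this
  · intro σ hσ
    rw [Finset.mem_filter] at hσ ⊢
    refine ⟨key σ hσ.1, ?_⟩
    have := hσ.2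
    rw [mem_Fl] at this ⊢
    simpa using this
  · intro σ _
    simp [mul_assoc]
  · intro σ _
    simp [mul_assoc]

lemma cnt_block (e : Subs 24 →₀ ℕ) (hne : (Rf e).Nonempty) (a : Fin 25) :
    ∃ s u : ℕ, s < u ∧
      (s = 0 ∨ s = 25 ∨ (s ∈ AA ∧ 1 ≤ e.mapDomain Finset.card s)) ∧
      (u = 0 ∨ u = 25 ∨ (u ∈ AA ∧ 1 ≤ e.mapDomain Finset.card u)) ∧
      ∀ k ∈ AA, (u - s) * cnt e k a = (Rf e).card * (min k u - min k s) := by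
  classical
  set lo := (e.support.filter (fun T => a ∉ T)).sup Finset.card with hlo
  set hi := insert 25 ((e.support.filter (fun T => a ∈ T)).image Finset.card) with hhi
  have hhine : hi.Nonempty := ⟨25, by simp [hhi]⟩
  set u := hi.min' hhine with hu
  have hu25 : u ≤ 25 := Finset.min'_le _ _ (by simp [hhi])
  have hmem : ∀ σ ∈ Rf e, ∀ T ∈ e.support, ∀ x, x ∈ T ↔ (σ x : ℕ) < T.card := by
    intro σ hσ T hT x
    simp only [Rf, Finset.mem_filter, Finset.mem_univ, true_and] at hσ
    rw [← mem_Fl, ← (hσ T hT).2]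
  have hAA : ∀ T ∈ e.support, T.card ∈ AA ∧ 1 ≤ e.mapDomain Finset.card T.card := by
    intro T hT
    obtain ⟨σ, hσ⟩ := hne
    simp only [Rf, Finset.mem_filter, Finset.mem_univ, true_and] at hσ
    refine ⟨(hσ T hT).1, ?_⟩
    rw [Finsupp.mapDomain, Finsupp.sum_apply, Finsupp.sum]
    have h1 : 1 ≤ e T := Nat.one_le_iff_ne_zero.mpr (by simpa using hT)
    refine h1.trans ?_
    have := Finset.single_le_sum (f := fun T' => (Finsupp.single T'.card (e T') : ℕ →₀ ℕ) T.card)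
      (fun _ _ => Nat.zero_le _) hT
    simpa using this
  have hu_mem : u = 25 ∨ ∃ T ∈ e.support, a ∈ T ∧ T.card = u := by
    have := Finset.min'_mem hi hhine
    rw [← hu, hhi] at this
    simp only [Finset.mem_insert, Finset.mem_image, Finset.mem_filter] at this
    rcases this with h | ⟨T, ⟨h1, h2⟩, h3⟩
    · exact Or.inl h
    · exact Or.inr ⟨T, h1, h2, h3⟩
  have hlo_mem : lo = 0 ∨ ∃ T ∈ e.support, a ∉ T ∧ T.card = lo := by
    rcases (e.support.filter (fun T => a ∉ T)).eq_empty_or_nonempty with h | h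
    · left; rw [hlo, h]; simp
    · right
      obtain ⟨T, hT, h2⟩ := Finset.exists_mem_eq_sup _ h Finset.card
      rw [Finset.mem_filter] at hT
      exact ⟨T, hT.1, hT.2, h2.symm⟩
  have hlo_le : ∀ T ∈ e.support, a ∉ T → T.card ≤ lo := by
    intro T hT h
    exact Finset.le_sup (f := Finset.card) (Finset.mem_filter.mpr ⟨hT, h⟩)
  have hu_le : ∀ T ∈ e.support, a ∈ T → u ≤ T.card := by
    intro T hT h
    apply Finset.min'_le
    simp only [hhi, Finset.mem_insert, Finset.mem_image, Finset.mem_filter]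
    exact Or.inr ⟨T, ⟨hT, h⟩, rfl⟩
  have hBl : ∀ σ ∈ Rf e, ∀ x : Fin 25, (∀ T ∈ e.support, a ∈ T ↔ x ∈ T) ↔
      (lo ≤ (σ x : ℕ) ∧ (σ x : ℕ) < u) := by
    intro σ hσ x
    constructor
    · intro h
      constructor
      · rcases hlo_mem with h0 | ⟨T, hT, h1, h2⟩
        · omega
        · have h3 : x ∉ T := fun hx => h1 ((h T hT).2 hx)
          rw [hmem σ hσ T hT] at h3
          omega
      · rcases hu_mem with h0 | ⟨T, hT, h1, h2⟩
        · have := (σ x).2; omega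
        · have h3 : x ∈ T := (h T hT).1 h1
          rw [hmem σ hσ T hT] at h3
          omega
    · rintro ⟨h1, h2⟩ T hT
      rw [hmem σ hσ T hT x]
      constructor
      · intro h; have := hu_le T hT h; omega
      · intro h; by_contra h'
        have := hlo_le T hT h'; omega
  have hlt : lo < u := by
    obtain ⟨σ, hσ⟩ := hne
    have := (hBl σ hσ a).1 (fun _ _ => Iff.rfl)
    omega
  refine ⟨lo, u, hlt, ?_, ?_, ?_⟩
  · rcases hlo_mem with h | ⟨T, hT, _, h⟩
    · exact Or.inl h
    · rw [← h]; exact Or.inr (Or.inr (hAA T hT))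
  · rcases hu_mem with h | ⟨T, hT, _, h⟩
    · exact Or.inr (Or.inl h)
    · rw [← h]; exact Or.inr (Or.inr (hAA T hT))
  · intro k hk
    have hk25 := AA_le hk
    set Bl : Finset (Fin 25) := Finset.univ.filter (fun x => ∀ T ∈ e.support, a ∈ T ↔ x ∈ T)
      with hBldef
    have hcard : Bl.card = u - lo := by
      obtain ⟨σ, hσ⟩ := hne
      rw [← card_range σ lo u hu25, hBldef]
      congr 1
      ext x
      simp only [Finset.mem_filter, Finset.mem_univ, true_and]
      exact hBl σ hσ x
    have h1 : ∑ x ∈ Bl, cnt e k x = (u - lo) * cnt e k a := by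
      rw [← hcard, ← smul_eq_mul, ← Finset.sum_const]
      refine Finset.sum_congr rfl fun x hx => ?_
      rw [hBldef, Finset.mem_filter] at hx
      exact (cnt_swap e k a x hx.2).symm
    rw [← h1]
    simp only [cnt, Finset.card_filter]
    rw [Finset.sum_comm, ← smul_eq_mul, ← Finset.sum_const]
    refine Finset.sum_congr rfl fun σ hσ => ?_
    rw [← Finset.card_filter]
    have h2 := card_range σ lo (min k u) (by omega)
    have h3 : min k u - lo = min k u - min k lo := by omega
    rw [← h3, ← h2, hBldef, Finset.filter_filter]
    congr 1
    ext x
    simp only [Finset.mem_filter, Finset.mem_univ, true_and]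
    rw [hBl σ hσ x, mem_Fl]
    omega

lemma phi_ell_eq (e : Subs 24 →₀ ℕ) (a : Fin 25) :
    ∑ σ : Equiv.Perm (Fin 25), Phi (ev σ (monomial e 1 * ell 24 a))
      = (Rf e).card * (∑ k ∈ AA, ww (e.mapDomain Finset.card) k * k) / 25 := by
  rw [phi_ell]
  rcases (Rf e).eq_empty_or_nonempty with h | h
  · simp [cnt, h]
  · obtain ⟨s, u, hsu, hs, hu, hc⟩ := cnt_block e h a
    have r1 := ww_rel _ s hs
    have r2 := ww_rel _ u hu
    set w := ww (e.mapDomain Finset.card)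
    have hsu' : ((u : ℚ) - s) ≠ 0 := by
      have : (s : ℚ) < u := by exact_mod_cast hsu
      linarith
    have h3 : ((u : ℚ) - s) * ∑ k ∈ AA, w k * cnt e k a
        = (Rf e).card * (∑ k ∈ AA, w k * (min k u : ℕ) - ∑ k ∈ AA, w k * (min k s : ℕ)) := by
      rw [← Finset.sum_sub_distrib, Finset.mul_sum, Finset.mul_sum]
      refine Finset.sum_congr rfl fun k hk => ?_
      have h4 := congrArg (fun z : ℕ => (z : ℚ)) (hc k hk)
      have h5 : min k s ≤ min k u := by omega
      simp only [Nat.cast_mul] at h4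
      rw [Nat.cast_sub hsu.le, Nat.cast_sub h5] at h4
      linear_combination w k * h4
    apply mul_left_cancel₀ hsu'
    rw [h3]
    linear_combination ((Rf e).card / 25 : ℚ) * (r2 - r1)

noncomputable def phi : Rd 24 →ₗ[ℚ] ℚ :=
  ∑ σ : Equiv.Perm (Fin 25), Phi ∘ₗ (ev σ).toLinearMap

lemma phi_apply (p : Rd 24) : phi p = ∑ σ : Equiv.Perm (Fin 25), Phi (ev σ p) := by
  simp [phi]

lemma lin_I2 (φ : Rd 24 →ₗ[ℚ] ℚ)
    (h : ∀ e a b, φ (monomial e 1 * ell 24 a) = φ (monomial e 1 * ell 24 b))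
    (p : Rd 24) (hp : p ∈ I2 24) : φ p = 0 := by
  have key : ∀ q : Rd 24, φ (q * p) = 0 := by
    unfold I2 at hp
    induction hp using Submodule.span_induction with
    | mem x hx =>
      obtain ⟨a, b, rfl⟩ := hx
      intro q
      induction q using MvPolynomial.induction_on' with
      | monomial e c =>
        have : (monomial e c : Rd 24) = c • monomial e 1 := by simp [smul_monomial]
        rw [this, smul_mul_assoc, map_smul, mul_sub, map_sub, h e a b, sub_self, smul_zero]
      | add p q hp hq => rw [add_mul, map_add, hp, hq, add_zero]
    | zero => intro q; simp
    | add x y _ _ hx hy => intro q; rw [mul_add, map_add, hx, hy, add_zero]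
    | smul c x _ hx => intro q; rw [smul_eq_mul, ← mul_assoc]; exact hx _
  have := key 1
  rwa [one_mul] at this

lemma phi_I2 (p : Rd 24) (hp : p ∈ I2 24) : phi p = 0 := by
  apply lin_I2 phi _ p hp
  intro e a b
  rw [phi_apply, phi_apply, phi_ell_eq, phi_ell_eq]

lemma ev_I1 (σ : Equiv.Perm (Fin 25)) (p : Rd 24) (hp : p ∈ I1 24) : ev σ p = 0 := by
  have : I1 24 ≤ RingHom.ker (ev σ) := by
    unfold I1
    rw [Ideal.span_le]
    rintro _ ⟨S, S', _, _, h1, h2, rfl⟩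
    rw [SetLike.mem_coe, RingHom.mem_ker, map_mul, ev_X, ev_X]
    by_cases hS : good σ S
    · by_cases hS' : good σ S'
      · exfalso
        rcases le_total S.card S'.card with h | h
        · apply h1
          rw [hS.2, hS'.2]
          intro x
          rw [mem_Fl, mem_Fl]
          omega
        · apply h2
          rw [hS.2, hS'.2]
          intro x
          rw [mem_Fl, mem_Fl]
          omega
      · rw [if_neg hS', mul_zero]
    · rw [if_neg hS, zero_mul]
  exact this hp

lemma phi_Itot (p : Rd 24) (hp : p ∈ Itot 24) : phi p = 0 := by
  unfold Itot at hp
  obtain ⟨y, hy, z, hz, rfl⟩ := Submodule.mem_sup.mp hp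
  rw [map_add, phi_I2 z hz, add_zero, phi_apply]
  exact Finset.sum_eq_zero fun σ _ => by rw [ev_I1 σ y hy, map_zero]

lemma tau_zero : tau 0 = 1 := by simp [tau]
lemma tau_one : tau 1 = 1/2 := by simp [tau]
lemma tau_two : tau 2 = 1/12 := by norm_num [tau, bernoulli'_two, Nat.factorial]
lemma tau_three : tau 3 = 0 := by simp [tau, bernoulli'_three]
lemma tau_four : tau 4 = -1/720 := by norm_num [tau, bernoulli'_four, Nat.factorial]

def tauQ : ℕ → ℚ
  | 0 => 1
  | 1 => 1/2
  | 2 => 1/12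
  | 4 => -1/720
  | _ => 0

lemma tau_eq (m : ℕ) (hm : m < 5) : tau m = tauQ m := by
  interval_cases m
  · exact tau_zero
  · exact tau_one
  · exact tau_two
  · exact tau_three
  · exact tau_four

lemma sum_trunc (f g : ℕ → ℚ) (h : ∀ m, 4 < m → f m = 0) (hg : ∀ m < 5, f m = g m) :
    ∑ m ∈ Finset.range 25, f m = ∑ m ∈ Finset.range 5, g m := by
  have : ∑ m ∈ Finset.range 5, f m = ∑ m ∈ Finset.range 25, f m := by
    apply Finset.sum_subset
    · intro x; simp only [Finset.mem_range]; omega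
    · intro x _ hx
      simp only [Finset.mem_range] at hx
      exact h x (by omega)
  rw [← this]
  exact Finset.sum_congr rfl fun m hm => hg m (Finset.mem_range.mp hm)

lemma final_sum : ∑ a ∈ Finset.range 5, ∑ b ∈ Finset.range 5, ∑ c ∈ Finset.range 5,
        ∑ d ∈ Finset.range 5, tauQ a * tauQ b * tauQ c * tauQ d * (tabZ a b c d : ℚ)
        = 2340 * (-19/1684800) := by
  decide +kernel

lemma ev_Td (σ : Equiv.Perm (Fin 25)) : ev σ (Td 24)
    = ∏ k ∈ AA, ∑ m ∈ Finset.range 25, C (tau m) * X k ^ m := by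
  unfold Td
  rw [map_prod, prod_good σ]
  · refine Finset.prod_congr rfl fun k hk => ?_
    rw [if_pos (proper_Fl σ hk), map_sum]
    refine Finset.sum_congr rfl fun m _ => ?_
    rw [map_mul, map_pow, ev_X, if_pos (good_Fl σ hk), card_Fl σ k (AA_le hk).2.le,
      ← MvPolynomial.algebraMap_eq, AlgHom.commutes, MvPolynomial.algebraMap_eq]
  · intro T hT
    rw [map_sum, Finset.sum_eq_single 0]
    · simp [tau_zero]
    · intro m _ hm
      rw [map_mul, map_pow, ev_X, if_neg hT, zero_pow hm, mul_zero]
    · simp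

lemma four_sum {R : Type*} [CommSemiring R] (s : Finset ℕ) (f g h k : ℕ → R) :
    (∑ a ∈ s, f a) * (∑ b ∈ s, g b) * (∑ c ∈ s, h c) * (∑ d ∈ s, k d)
      = ∑ a ∈ s, ∑ b ∈ s, ∑ c ∈ s, ∑ d ∈ s, f a * g b * h c * k d := by
  simp only [← Finset.mul_sum, ← Finset.sum_mul]

lemma Phi_Td : Phi (∏ k ∈ AA, ∑ m ∈ Finset.range 25, C (tau m) * X k ^ m)
    = 2340 * (-19/1684800) := by
  have h1 : Phi (∏ k ∈ AA, ∑ m ∈ Finset.range 25, C (tau m) * X k ^ m)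
      = ∑ a ∈ Finset.range 25, ∑ b ∈ Finset.range 25, ∑ c ∈ Finset.range 25,
        ∑ d ∈ Finset.range 25, tau a * tau b * tau c * tau d * (tabZ a b c d : ℚ) := by
    rw [prodAA, four_sum]
    simp only [map_sum]
    have hm : ∀ a b c d : ℕ, Phi (C (tau a) * X 10 ^ a * (C (tau b) * X 12 ^ b) *
        (C (tau c) * X 13 ^ c) * (C (tau d) * X 15 ^ d))
        = tau a * tau b * tau c * tau d * (tabZ a b c d : ℚ) := by
      intro a b c d
      simp only [C_mul_X_pow_eq_monomial, monomial_mul, Phi_mono]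
      simp [tabE]
    simp only [hm]
  rw [h1, ← final_sum]
  have z : ∀ a b c d : ℕ, 4 < a ∨ 4 < b ∨ 4 < c ∨ 4 < d → (tabZ a b c d : ℚ) = 0 := by
    intro a b c d h
    rw [tabZ_ne a b c d (by omega), Int.cast_zero]
  apply sum_trunc
  · intro a ha
    simp [z a _ _ _ (Or.inl ha)]
  intro a ha
  apply sum_trunc
  · intro b hb
    simp [z a b _ _ (Or.inr (Or.inl hb))]
  intro b hb
  apply sum_trunc
  · intro c hc
    simp [z a b c _ (Or.inr (Or.inr (Or.inl hc)))]
  intro c hc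
  apply sum_trunc
  · intro d hd
    simp [z a b c d (Or.inr (Or.inr (Or.inr hd)))]
  intro d hd
  rw [tau_eq a ha, tau_eq b hb, tau_eq c hc, tau_eq d hd]

lemma tabE_sum (σ : Equiv.Perm (Fin 25)) (H : Finset (Subs 24)) (hH : ∀ T ∈ H, good σ T) :
    Phi (ev σ (chainMon 24 H)) = if H = AA.image (Fl σ) then 2340 else 0 := by
  unfold chainMon
  have h1 : ev σ (∏ T ∈ H, X T) = monomial (∑ T ∈ H, Finsupp.single T.card 1) 1 := by
    rw [map_prod, monomial_sum_one]
    refine Finset.prod_congr rfl fun T hT => ?_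
    rw [ev_X, if_pos (hH T hT), X]
  rw [h1, Phi_mono, one_mul, tabE]
  have h2 : ∀ k ∈ AA, (∑ T ∈ H, Finsupp.single T.card 1 : ℕ →₀ ℕ) k
      = if Fl σ k ∈ H then 1 else 0 := by
    intro k hk
    rw [Finsupp.finsetSum_apply]
    rw [← Finset.sum_ite_eq' H (Fl σ k) (fun _ => 1)]
    refine Finset.sum_congr rfl fun T hT => ?_
    rw [Finsupp.single_apply]
    have : T.card = k ↔ T = Fl σ k := by
      constructor
      · intro h; rw [← h]; exact (hH T hT).2
      · intro h; rw [h, card_Fl σ k (AA_le hk).2.le]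
    simp only [this]
  rw [h2 10 (by decide), h2 12 (by decide), h2 13 (by decide), h2 15 (by decide)]
  have h3 : H = AA.image (Fl σ) ↔ ∀ k ∈ AA, Fl σ k ∈ H := by
    constructor
    · intro h k hk; rw [h]; exact Finset.mem_image_of_mem _ hk
    · intro h
      ext T
      rw [Finset.mem_image]
      constructor
      · intro hT; exact ⟨T.card, (hH T hT).1, (hH T hT).2.symm⟩
      · rintro ⟨k, hk, rfl⟩; exact h k hk
  have h4 : (∀ k ∈ AA, Fl σ k ∈ H) ↔ Fl σ 10 ∈ H ∧ Fl σ 12 ∈ H ∧ Fl σ 13 ∈ H ∧ Fl σ 15 ∈ H := by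
    simp [AA]
  have h5 := h3.trans h4
  clear h1 h2 h3 h4 hH
  by_cases c : H = AA.image (Fl σ)
  · obtain ⟨c1, c2, c3, c4⟩ := h5.1 c
    rw [if_pos c1, if_pos c2, if_pos c3, if_pos c4, if_pos c]
    have : tabZ 1 1 1 1 = 2340 := by decide
    rw [this]; norm_num
  · rw [if_neg c, tabZ_ne, Int.cast_zero]
    rw [h5] at c
    split_ifs <;> first | omega | tauto

lemma Phi_sum (σ : Equiv.Perm (Fin 25)) (r : Finset (Subs 24) → ℚ) (F : Finset (Finset (Subs 24)))
    (hF : AA.image (Fl σ) ∈ F) :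
    Phi (ev σ (∑ H ∈ F, C (r H) * chainMon 24 H)) = 2340 * r (AA.image (Fl σ)) := by
  rw [map_sum, map_sum, Finset.sum_eq_single (AA.image (Fl σ))]
  · rw [C_mul', map_smul, map_smul, tabE_sum, if_pos rfl, smul_eq_mul, mul_comm]
    intro T hT
    obtain ⟨k, hk, rfl⟩ := Finset.mem_image.mp hT
    exact good_Fl σ hk
  · intro H _ hne
    rw [C_mul', map_smul, map_smul]
    by_cases hH : ∀ T ∈ H, good σ T
    · rw [tabE_sum σ H hH, if_neg hne, smul_zero]
    · push Not at hH
      obtain ⟨T, hT, hg⟩ := hH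
      have : ev σ (chainMon 24 H) = 0 := by
        unfold chainMon
        rw [map_prod]
        apply Finset.prod_eq_zero hT
        rw [ev_X, if_neg hg]
      rw [this, map_zero, smul_zero]
  · intro h; exact absurd hF h

lemma flag_chain (σ : Equiv.Perm (Fin 25)) : IsProperChain 24 (AA.image (Fl σ)) := by
  constructor
  · intro T hT
    obtain ⟨k, hk, rfl⟩ := Finset.mem_image.mp hT
    exact proper_Fl σ hk
  · intro T hT T' hT'
    obtain ⟨k, hk, rfl⟩ := Finset.mem_image.mp hT
    obtain ⟨l, hl, rfl⟩ := Finset.mem_image.mp hT'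
    rcases le_total k l with h | h
    · left; intro x; rw [mem_Fl, mem_Fl]; omega
    · right; intro x; rw [mem_Fl, mem_Fl]; omega

lemma flag_card (σ : Equiv.Perm (Fin 25)) : (AA.image (Fl σ)).image Finset.card = AA := by
  rw [Finset.image_image]
  conv_rhs => rw [← Finset.image_id (s := AA)]
  apply Finset.image_congr
  intro k hk
  exact card_Fl σ k (AA_le hk).2.le

/-- Example `ex:negative`: for `d = 24`, any symmetric square-free
representation `r` of the Todd class takes the value `−19/1684800` on every 4-chain
`S₁ ⊊ S₂ ⊊ S₃ ⊊ S₄` with `|S₁| = 10`, `|S₂| = 12`, `|S₃| = 13`, `|S₄| = 15`; in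
particular this value is negative, disproving the positivity conjecture for the
Berline–Vergne function on braid fans. -/
theorem stmt8 (r : Finset (Subs 24) → ℚ)
    (hsym : ∀ H H' : Finset (Subs 24), IsProperChain 24 H → IsProperChain 24 H' →
      H.image Finset.card = H'.image Finset.card → r H = r H')
    (hTd : (∑ H ∈ Finset.univ.filter (fun H : Finset (Subs 24) => IsProperChain 24 H),
        C (r H) * chainMon 24 H) - Td 24 ∈ Itot 24)
    (S1 S2 S3 S4 : Subs 24)
    (h12 : S1 ⊂ S2) (h23 : S2 ⊂ S3) (h34 : S3 ⊂ S4)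
    (hc1 : S1.card = 10) (hc2 : S2.card = 12) (hc3 : S3.card = 13) (hc4 : S4.card = 15) :
    r {S1, S2, S3, S4} = -19/1684800 ∧ r {S1, S2, S3, S4} < 0 := by
  have hproper : ∀ S : Subs 24, 0 < S.card → S.card < 25 → isProper 24 S := by
    intro S h0 h1
    constructor
    · rintro rfl; simp at h0
    · rintro rfl; simp at h1
  have hchain : IsProperChain 24 {S1, S2, S3, S4} := by
    constructor
    · intro T hT
      simp only [Finset.mem_insert, Finset.mem_singleton] at hT
      rcases hT with rfl | rfl | rfl | rfl <;> apply hproper <;> omega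
    · have a12 := h12.subset
      have a23 := h23.subset
      have a34 := h34.subset
      have a13 := a12.trans a23
      have a24 := a23.trans a34
      have a14 := a13.trans a34
      intro T hT T' hT'
      simp only [Finset.mem_insert, Finset.mem_singleton] at hT hT'
      rcases hT with rfl | rfl | rfl | rfl <;> rcases hT' with rfl | rfl | rfl | rfl <;>
        simp [*]
  have hcard : ({S1, S2, S3, S4} : Finset (Subs 24)).image Finset.card = AA := by
    simp [Finset.image_insert, hc1, hc2, hc3, hc4, AA]
  have hval : ∀ σ : Equiv.Perm (Fin 25), r (AA.image (Fl σ)) = r {S1, S2, S3, S4} := by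
    intro σ
    exact hsym _ _ (flag_chain σ) hchain (by rw [flag_card, hcard])
  have h := phi_Itot _ hTd
  rw [map_sub, sub_eq_zero, phi_apply, phi_apply] at h
  have hL : ∀ σ : Equiv.Perm (Fin 25), Phi (ev σ
      (∑ H ∈ Finset.univ.filter (fun H : Finset (Subs 24) => IsProperChain 24 H),
        C (r H) * chainMon 24 H)) = 2340 * r {S1, S2, S3, S4} := by
    intro σ
    rw [Phi_sum σ r, hval]
    exact Finset.mem_filter.mpr ⟨Finset.mem_univ _, flag_chain σ⟩
  have hR : ∀ σ : Equiv.Perm (Fin 25), Phi (ev σ (Td 24)) = 2340 * (-19/1684800) := by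
    intro σ
    rw [ev_Td, Phi_Td]
  rw [Finset.sum_congr rfl fun σ _ => hL σ, Finset.sum_congr rfl fun σ _ => hR σ,
    Finset.sum_const, Finset.sum_const, nsmul_eq_mul, nsmul_eq_mul] at h
  have hN : ((Finset.univ : Finset (Equiv.Perm (Fin 25))).card : ℚ) ≠ 0 :=
    Nat.cast_ne_zero.mpr (Finset.card_ne_zero_of_mem (Finset.mem_univ 1))
  have h' := mul_left_cancel₀ hN h
  have h'' : r {S1, S2, S3, S4} = -19/1684800 := by linarith
  exact ⟨h'', by rw [h'']; norm_num⟩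
end

section
/- Let d ≥ 1, 1 ≤ k ≤ d, and let t be a nonnegative integer. Then the number of points x = (x_1,…,x_{d+1}) ∈ ℤ^{d+1} with 0 ≤ x_j ≤ t for all j and x_1 + ⋯ + x_{d+1} = kt (i.e., the number of lattice points in the t-th dilate of the hypersimplex Δ_{k,d+1}) equals ∑_{i=0}^{k} (−1)^i·C(d+1, i)·C(d + t(k−i) − i, d), where C(·,·) denotes the binomial coefficient. -/
open PowerSeries in
theorem geom_aux (d t : ℕ) :
    ((∑ j ∈ Finset.range (t + 1), (X : ℤ⟦X⟧) ^ j) ^ (d + 1)) =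
      ∑ i ∈ Finset.range (d + 2), (PowerSeries.mk fun n => ((d + n).choose d : ℤ)) *
        (C ((-1) ^ i * ((d + 1).choose i : ℤ)) * X ^ ((t + 1) * i)) := by
  have h1 : (∑ j ∈ Finset.range (t + 1), (X : ℤ⟦X⟧) ^ j) * (1 - X) = 1 - X ^ (t + 1) :=
    geom_sum_mul_neg _ _
  have h2 : (PowerSeries.mk fun n => ((d + n).choose d : ℤ)) * (1 - X) ^ (d + 1) = 1 :=
    PowerSeries.mk_add_choose_mul_one_sub_pow_eq_one ℤ d
  have h3 : (1 - (X : ℤ⟦X⟧) ^ (t + 1)) ^ (d + 1) =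
      ∑ i ∈ Finset.range (d + 2), (C ((-1) ^ i * ((d + 1).choose i : ℤ)) * X ^ ((t + 1) * i)) := by
    rw [sub_eq_neg_add, add_pow]
    refine Finset.sum_congr rfl fun i _ => ?_
    rw [neg_pow, one_pow, pow_mul]
    simp
    ring
  rw [← Finset.mul_sum, ← h3, ← h1, mul_pow]
  linear_combination (-(∑ j ∈ Finset.range (t + 1), (X : ℤ⟦X⟧) ^ j) ^ (d + 1)) * h2

open PowerSeries in
theorem count_aux (d t m : ℕ) :
    (((Finset.Icc (0 : Fin (d + 1) → ℤ) (fun _ => (t : ℤ))).filter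
        (fun x => ∑ j, x j = (m : ℤ))).card : ℤ) =
    coeff m ((∑ j ∈ Finset.range (t + 1), (X : ℤ⟦X⟧) ^ j) ^ (d + 1)) := by
  have h1 : (∑ j ∈ Finset.range (t + 1), (X : ℤ⟦X⟧) ^ j) =
      ∑ j ∈ Finset.Icc (0 : ℤ) t, (X : ℤ⟦X⟧) ^ j.toNat := by
    refine Finset.sum_bij' (fun j _ => (j : ℤ)) (fun j _ => j.toNat) ?_ ?_ ?_ ?_ ?_ <;>
      simp <;> omega
  have h2 : ((∑ j ∈ Finset.Icc (0 : ℤ) t, (X : ℤ⟦X⟧) ^ j.toNat) ^ (d + 1)) =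
      ∏ _i : Fin (d + 1), ∑ j ∈ Finset.Icc (0 : ℤ) t, (X : ℤ⟦X⟧) ^ j.toNat := by
    simp
  rw [h1, h2, Finset.prod_univ_sum, map_sum, Finset.card_filter, Nat.cast_sum]
  refine Finset.sum_congr rfl fun x hx => ?_
  rw [Finset.prod_pow_eq_pow_sum, coeff_X_pow]
  have hx0 : ∀ j, 0 ≤ x j := fun j => by
    have := Fintype.mem_piFinset.1 hx j
    exact (Finset.mem_Icc.1 this).1
  have : ((∑ j, (x j).toNat : ℕ) : ℤ) = ∑ j, x j := by
    push_cast
    exact Finset.sum_congr rfl fun j _ => by simp [hx0 j]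
  rw [← this]
  push_cast
  congr 1
  norm_cast
  simp [eq_comm]

/-- the number of lattice points in the `t`-th dilate of the
hypersimplex `Δ_{k,d+1}`, i.e. of points `x ∈ ℤ^{d+1}` with `0 ≤ x_j ≤ t` and
`∑_j x_j = kt`, equals `∑_{i=0}^{k} (−1)^i·C(d+1,i)·C(d+t(k−i)−i, d)`. -/
theorem stmt10 (d k t : ℕ) (hd : 1 ≤ d) (hk1 : 1 ≤ k) (hk2 : k ≤ d) :
    (((Finset.Icc (0 : Fin (d + 1) → ℤ) (fun _ => (t : ℤ))).filter
        (fun x => ∑ j, x j = (k : ℤ) * (t : ℤ))).card : ℤ) =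
      ∑ i ∈ Finset.range (k + 1), (-1) ^ i * ((d + 1).choose i : ℤ) *
        ((d + t * (k - i) - i).choose d : ℤ) := by
  have h := count_aux d t (k * t)
  rw [Nat.cast_mul] at h
  rw [h, geom_aux, map_sum]
  symm
  have hc : ∀ i, PowerSeries.coeff (k * t) ((PowerSeries.mk fun n => ((d + n).choose d : ℤ)) *
        (PowerSeries.C ((-1) ^ i * ((d + 1).choose i : ℤ)) * PowerSeries.X ^ ((t + 1) * i))) =
      if (t + 1) * i ≤ k * t then (-1) ^ i * ((d + 1).choose i : ℤ) *
        ((d + (k * t - (t + 1) * i)).choose d : ℤ) else 0 := by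
    intro i
    rw [mul_left_comm, PowerSeries.coeff_C_mul, PowerSeries.coeff_mul_X_pow']
    split_ifs <;> simp
  simp only [hc]
  rw [← Finset.sum_subset (s₁ := Finset.range (k + 1)) (s₂ := Finset.range (d + 2))]
  · refine Finset.sum_congr rfl fun i hi => ?_
    have hik : i ≤ k := by simpa [Nat.lt_succ_iff] using hi
    obtain ⟨c, rfl⟩ := Nat.exists_eq_add_of_le hik
    have e1 : (i + c) * t = t * i + t * c := by ring
    have e2 : (t + 1) * i = t * i + i := by ring
    rw [e1, e2, Nat.add_sub_cancel_left]
    split_ifs with hle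
    · congr 3
      omega
    · rw [Nat.choose_eq_zero_of_lt (show d + t * c - i < d by omega)]
      simp
  · intro i
    simp only [Finset.mem_range]
    omega
  · intro i _ hi
    rw [if_neg]
    simp only [Finset.mem_range] at hi
    have : k * t ≤ i * t := Nat.mul_le_mul_right _ (by omega)
    have e2 : (t + 1) * i = i * t + i := by ring
    omega
end

section
/- Let d ≥ 1 and 1 ≤ k ≤ d. Then ∑_{i=1}^{k} ( k/i − (d+1)(k−i)/(i(d+1−i)) ) + ∑_{i=k+1}^{d} k/i > 0, where all terms are rational numbers. (This quantity is the linear coefficient of the Ehrhart polynomial of the hypersimplex Δ_{k,d+1}; moreover each summand in the first sum is nonnegative because k/(k−i) ≥ (d+1)/(d+1−i) for 1 ≤ i < k ≤ d.) -/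
/-- Lemma `lem:computation`: for `1 ≤ k ≤ d`,
`∑_{i=1}^{k} (k/i − (d+1)(k−i)/(i(d+1−i))) + ∑_{i=k+1}^{d} k/i > 0`
(this is the linear Ehrhart coefficient of the hypersimplex `Δ_{k,d+1}`). -/
theorem stmt11 (d k : ℕ) (hd : 1 ≤ d) (hk1 : 1 ≤ k) (hk2 : k ≤ d) :
    0 < (∑ i ∈ Finset.Icc 1 k,
          ((k : ℚ) / (i : ℚ) -
            ((d : ℚ) + 1) * ((k : ℚ) - (i : ℚ)) / ((i : ℚ) * ((d : ℚ) + 1 - (i : ℚ))))) +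
        ∑ i ∈ Finset.Icc (k + 1) d, (k : ℚ) / (i : ℚ) := by
  apply add_pos_of_pos_of_nonneg
  · apply Finset.sum_pos
    · intro i hi
      rw [Finset.mem_Icc] at hi
      have h1 : (0 : ℚ) < i := by exact_mod_cast hi.1
      have h2 : (i : ℚ) ≤ k := by exact_mod_cast hi.2
      have h3 : (k : ℚ) ≤ d := by exact_mod_cast hk2
      have h4 : (0 : ℚ) < (d : ℚ) + 1 - i := by linarith
      have h5 : (0 : ℚ) < (d : ℚ) + 1 - k := by linarith
      have e : (k : ℚ) / (i : ℚ) -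
            ((d : ℚ) + 1) * ((k : ℚ) - (i : ℚ)) / ((i : ℚ) * ((d : ℚ) + 1 - (i : ℚ)))
          = ((d : ℚ) + 1 - k) / ((d : ℚ) + 1 - i) := by
        have h1' := h1.ne'
        have h4' := h4.ne'
        rw [div_sub_div _ _ h1' (mul_ne_zero h1' h4'),
          div_eq_div_iff (mul_ne_zero h1' (mul_ne_zero h1' h4')) h4']
        ring
      rw [e]
      exact div_pos h5 h4
    · exact Finset.nonempty_Icc.mpr hk1
  · exact Finset.sum_nonneg fun i _ => by positivity
end

section
/- Let d ≥ 1 and 1 ≤ k ≤ d. Suppose p is a polynomial with rational coefficients such that for every positive integer t, p(t) equals the number of points x ∈ ℤ^{d+1} with 0 ≤ x_j ≤ t for all j and x_1 + ⋯ + x_{d+1} = kt (the number of lattice points in the t-th dilate of the hypersimplex Δ_{k,d+1}). Then the coefficient of t^1 in p is positive. -/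
open Polynomial in
noncomputable def hsF (d : ℕ) (a b : ℚ) : ℚ[X] :=
  ∏ j ∈ Finset.range d, (C a * X + C ((j : ℚ) + 1 - b))

open Polynomial in
lemma hsF_zero (d : ℕ) (a : ℚ) :
    (hsF d a 0).coeff 0 = (d.factorial : ℚ) ∧
    (hsF d a 0).coeff 1 = a * d.factorial * ∑ j ∈ Finset.range d, (1 : ℚ) / (j + 1) := by
  induction d with
  | zero => simp [hsF, coeff_one]
  | succ d ih =>
    obtain ⟨h0, h1⟩ := ih
    have e : hsF (d+1) a 0 = hsF d a 0 * (C a * X + C ((d : ℚ) + 1 - 0)) := by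
      simp [hsF, Finset.prod_range_succ]
    have e2 : hsF (d+1) a 0 = C a * (hsF d a 0 * X) + C ((d : ℚ) + 1) * hsF d a 0 := by
      rw [e, sub_zero]; ring
    constructor
    · rw [e2]
      simp only [coeff_add, coeff_C_mul, mul_coeff_zero, coeff_X_zero, h0]
      rw [Nat.factorial_succ]; push_cast
      simp
    · rw [e2]
      simp only [coeff_add, coeff_C_mul, h1]
      rw [show (1 : ℕ) = 0 + 1 from rfl, coeff_mul_X, h0, Finset.sum_range_succ, Nat.factorial_succ]
      push_cast
      have : (d : ℚ) + 1 ≠ 0 := by positivity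
      field_simp
      ring

lemma hs_prod1 (m : ℕ) : ∏ j ∈ Finset.range m, ((j : ℚ) - m) = (-1) ^ m * m.factorial := by
  rw [← Finset.prod_range_reflect, ← Finset.prod_range_add_one_eq_factorial]
  push_cast
  rw [← Finset.card_range m, ← Finset.prod_const, Finset.card_range, ← Finset.prod_mul_distrib]
  refine Finset.prod_congr rfl fun j hj => ?_
  have := Finset.mem_range.1 hj
  rw [show m - 1 - j = m - (j + 1) by omega, Nat.cast_sub (by omega)]
  push_cast; ring

open Polynomial in
lemma hsF_succ (m r : ℕ) (a : ℚ) :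
    (hsF (m + 1 + r) a ((m : ℚ) + 1)).coeff 1 = a * ((-1) ^ m * m.factorial * r.factorial) := by
  rw [hsF, Finset.prod_range_add, Finset.prod_range_succ]
  have : C a * X + C ((m : ℚ) + 1 - (m + 1)) = C a * X := by simp
  rw [this]
  set A := ∏ j ∈ Finset.range m, (C a * X + C ((j : ℚ) + 1 - (m + 1)))
  set B := ∏ j ∈ Finset.range r, (C a * X + C (((m + 1 + j : ℕ) : ℚ) + 1 - (m + 1)))
  have hA : A.coeff 0 = (-1) ^ m * m.factorial := by
    rw [coeff_zero_eq_eval_zero, eval_prod, ← hs_prod1]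
    refine Finset.prod_congr rfl fun j _ => ?_
    simp
  have hB : B.coeff 0 = r.factorial := by
    rw [coeff_zero_eq_eval_zero, eval_prod, ← Finset.prod_range_add_one_eq_factorial]
    push_cast
    refine Finset.prod_congr rfl fun j _ => ?_
    simp
    ring
  rw [show A * (C a * X) * B = C a * ((A * B) * X) by ring, coeff_C_mul,
    show (1 : ℕ) = 0 + 1 from rfl, coeff_mul_X, mul_coeff_zero, hA, hB]

lemma hsF_eval (d : ℕ) (s : ℕ) (a b t : ℚ) (h : a * t - b = s) :
    (hsF d a b).eval t / d.factorial = ((d + s).choose d : ℚ) := by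
  have h1 : (hsF d a b).eval t = ((s + 1).ascFactorial d : ℕ) := by
    rw [hsF, Polynomial.eval_prod, Nat.ascFactorial_eq_prod_range]
    push_cast
    refine Finset.prod_congr rfl fun j _ => ?_
    simp
    linarith
  rw [h1, Nat.ascFactorial_eq_factorial_mul_choose, add_comm d s]
  push_cast
  have : (d.factorial : ℚ) ≠ 0 := by positivity
  field_simp

lemma hsF_eval_zero (d : ℕ) (s : ℕ) (hs : s < d) (a b t : ℚ) (h : a * t - b = -((s : ℚ) + 1)) :
    (hsF d a b).eval t = 0 := by
  rw [hsF, Polynomial.eval_prod]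
  refine Finset.prod_eq_zero (Finset.mem_range.2 hs) ?_
  simp
  linarith

open PowerSeries in
lemma hs_count (d t s : ℕ) :
    ((((Finset.Icc (0 : Fin (d + 1) → ℤ) (fun _ => (t : ℤ))).filter
          (fun x => ∑ j, x j = (s : ℤ))).card : ℚ)) =
    ∑ i ∈ Finset.range (d + 2), (-1) ^ i * ((d + 1).choose i : ℚ) *
      (if i * (t + 1) ≤ s then ((d + (s - i * (t + 1))).choose d : ℚ) else 0) := by
  have key : (∑ m ∈ Finset.Icc (0 : ℤ) t, (X : ℚ⟦X⟧) ^ m.toNat) = 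
      ∑ m ∈ Finset.range (t + 1), (X : ℚ⟦X⟧) ^ m := by
    refine Finset.sum_nbij' (fun m => m.toNat) (fun m => (m : ℤ)) ?_ ?_ ?_ ?_ ?_
    · intro m hm; simp at hm ⊢; omega
    · intro m hm; simp at hm ⊢; omega
    · intro m hm; simp at hm ⊢; omega
    · intro m hm; simp
    · intro m hm; rfl
  have L : coeff s ((∑ m ∈ Finset.range (t + 1), (X : ℚ⟦X⟧) ^ m) ^ (d + 1)) =
      ((((Finset.Icc (0 : Fin (d + 1) → ℤ) (fun _ => (t : ℤ))).filter
          (fun x => ∑ j, x j = (s : ℤ))).card : ℚ)) := by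
    rw [← key]
    have : (∑ m ∈ Finset.Icc (0 : ℤ) t, (X : ℚ⟦X⟧) ^ m.toNat) ^ (d + 1) =
      ∏ _j : Fin (d + 1), (∑ m ∈ Finset.Icc (0 : ℤ) t, (X : ℚ⟦X⟧) ^ m.toNat) := by simp
    rw [this, Finset.prod_univ_sum, map_sum, Finset.card_filter]
    push_cast
    refine Finset.sum_congr rfl fun x hx => ?_
    rw [Finset.prod_pow_eq_pow_sum, coeff_X_pow]
    have h2 : ((∑ j, (x j).toNat : ℕ) : ℤ) = ∑ j, x j := by
      push_cast
      refine Finset.sum_congr rfl fun j _ => ?_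
      exact Int.toNat_of_nonneg ((Finset.mem_Icc.1 hx).1 j)
    refine if_congr ?_ rfl rfl
    rw [← h2]; norm_cast; exact eq_comm
  rw [← L]
  have g : (∑ m ∈ Finset.range (t + 1), (X : ℚ⟦X⟧) ^ m) = (1 - X ^ (t + 1)) * mk 1 := by
    have h1 := geom_sum_mul_neg (X : ℚ⟦X⟧) (t + 1)
    have h2 := mk_one_mul_one_sub_eq_one ℚ
    rw [← h1, mul_assoc, mul_comm (1 - X) (mk 1), h2, mul_one]
  rw [g, mul_pow, mk_one_pow_eq_mk_choose_add, sub_eq_add_neg, add_comm, add_pow, Finset.sum_mul,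
    map_sum]
  refine Finset.sum_congr rfl fun i _ => ?_
  have : (-(X : ℚ⟦X⟧) ^ (t + 1)) ^ i * 1 ^ (d + 1 - i) * ((d + 1).choose i : ℚ⟦X⟧) *
      (mk fun n => ((d + n).choose d : ℚ)) = C ((-1) ^ i * ((d + 1).choose i : ℚ)) *
       (X ^ (i * (t + 1)) * (mk fun n => ((d + n).choose d : ℚ))) := by
    rw [neg_pow, ← pow_mul, mul_comm (t + 1) i]
    simp
    ring
  rw [this, coeff_C_mul, coeff_X_pow_mul']
  simp

open Polynomial in
noncomputable def hsQ (d k : ℕ) : ℚ[X] :=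
  ∑ i ∈ Finset.range k, C ((-1) ^ i * ((d + 1).choose i : ℚ) / d.factorial) * hsF d ((k : ℚ) - i) i

lemma hsQ_eval (d k t : ℕ) (hk1 : 1 ≤ k) (hk2 : k ≤ d) (ht : 1 ≤ t) :
    (hsQ d k).eval (t : ℚ) = ∑ i ∈ Finset.range (d + 2), (-1) ^ i * ((d + 1).choose i : ℚ) *
      (if i * (t + 1) ≤ k * t then ((d + (k * t - i * (t + 1))).choose d : ℚ) else 0) := by
  rw [← Finset.sum_subset (Finset.range_mono (show k ≤ d + 2 by omega)), hsQ,
    Polynomial.eval_finset_sum]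
  · refine Finset.sum_congr rfl fun i hi => ?_
    have hi := Finset.mem_range.1 hi
    rw [Polynomial.eval_mul, Polynomial.eval_C, div_mul_eq_mul_div, mul_div_assoc]
    congr 1
    split_ifs with h
    · apply hsF_eval
      rw [Nat.cast_sub h]; push_cast; ring
    · push Not at h
      have h3 : k * t ≥ (i + 1) * t := Nat.mul_le_mul_right _ hi
      rw [hsF_eval_zero d (i * (t + 1) - k * t - 1) (by
        have : i * (t+1) = i * t + i := by ring
        have : (i+1) * t = i * t + t := by ring
        omega), zero_div]
      rw [Nat.cast_sub (by omega), Nat.cast_sub (by omega)]; push_cast; ring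
  · intro i _ hi
    have hi : k ≤ i := by simpa using hi
    have h3 : k * (t + 1) ≤ i * (t + 1) := Nat.mul_le_mul_right _ hi
    rw [if_neg, mul_zero]
    have : k * (t+1) = k * t + k := by ring
    omega

lemma hsQ_coeff (d k : ℕ) (hk1 : 1 ≤ k) (hk2 : k ≤ d) : 0 < (hsQ d k).coeff 1 := by
  obtain ⟨k, rfl⟩ : ∃ l, k = l + 1 := ⟨k - 1, by omega⟩
  have hf : (d.factorial : ℚ) ≠ 0 := by positivity
  rw [hsQ, Polynomial.finset_sum_coeff, Finset.sum_range_succ']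
  simp only [Polynomial.coeff_C_mul]
  have h0 := (hsF_zero d ((k + 1 : ℕ) : ℚ)).2
  have e0 : (-1 : ℚ) ^ 0 * ((d + 1).choose 0 : ℚ) / d.factorial *
      (hsF d (((k + 1 : ℕ) : ℚ) - ((0 : ℕ) : ℚ)) ((0 : ℕ) : ℚ)).coeff 1 =
      ∑ j ∈ Finset.range d, ((k : ℚ) + 1) / (j + 1) := by
    simp only [Nat.cast_zero, sub_zero, h0]
    rw [Finset.mul_sum, Finset.mul_sum]
    refine Finset.sum_congr rfl fun j _ => ?_
    push_cast
    simp
    field_simp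
  rw [e0]
  have h1 : ∑ j ∈ Finset.range k, ((k : ℚ) + 1) / (j + 1) <
      ∑ j ∈ Finset.range d, ((k : ℚ) + 1) / (j + 1) := by
    refine Finset.sum_lt_sum_of_subset (i := k) (Finset.range_mono (by omega))
      (Finset.mem_range.2 (by omega)) (by simp) (by positivity) fun j _ _ => by positivity
  have h2 : ∑ m ∈ Finset.range k, -(((k : ℚ) + 1) / (m + 1)) ≤
      ∑ m ∈ Finset.range k, (-1 : ℚ) ^ (m + 1) * ((d + 1).choose (m + 1) : ℚ) / d.factorial *
      (hsF d (((k + 1 : ℕ) : ℚ) - ((m + 1 : ℕ) : ℚ)) ((m + 1 : ℕ) : ℚ)).coeff 1 := by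
    refine Finset.sum_le_sum fun m hm => ?_
    have hm := Finset.mem_range.1 hm
    obtain ⟨r, rfl⟩ : ∃ r, d = m + 1 + r := ⟨d - (m + 1), by omega⟩
    have hc := Nat.add_choose_mul_factorial_mul_factorial (m + 1) (r + 1)
    have hc' : ((m + 1 + r + 1).choose (m + 1) : ℚ) * ((m + 1) * m.factorial) *
        ((r + 1) * r.factorial) = (m + 1 + r + 1) * (m + 1 + r).factorial := by
      rw [← Nat.choose_symm_add, ← add_assoc, Nat.factorial_succ, Nat.factorial_succ, Nat.factorial_succ] at hc
      exact_mod_cast hc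
    have hs := hsF_succ m r (((k + 1 : ℕ) : ℚ) - ((m + 1 : ℕ) : ℚ))
    rw [show ((m + 1 : ℕ) : ℚ) = (m : ℚ) + 1 by push_cast; rfl] at hs ⊢
    rw [hs]
    set N : ℚ := ((m + 1 + r + 1).choose (m + 1) : ℚ)
    have hN : N * m.factorial * r.factorial / (m + 1 + r).factorial =
        (m + 1 + r + 1) / ((m + 1) * (r + 1)) := by
      field_simp
      linarith
    have hsg : (-1 : ℚ) ^ m * (-1) ^ m = 1 := by rw [← mul_pow]; simp
    have e : (-1 : ℚ) ^ (m + 1) * N / (m + 1 + r).factorial *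
        ((((k + 1 : ℕ) : ℚ) - (m + 1)) * ((-1) ^ m * m.factorial * r.factorial)) =
        - (((k : ℚ) - m) * ((m + 1 + r + 1) / ((m + 1) * (r + 1)))) := by
      rw [← hN]
      push_cast
      linear_combination (-(N / (m + 1 + r).factorial * (k - m) * m.factorial * r.factorial)) * hsg
    rw [e, neg_le_neg_iff]
    have hk : (k : ℚ) ≤ m + 1 + r := by exact_mod_cast (by omega : k ≤ m + 1 + r)
    rw [← mul_div_assoc, div_le_div_iff₀ (by positivity) (by positivity)]
    have : ((k : ℚ) - m) * (m + 1 + r + 1) ≤ (k + 1) * (r + 1) := by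
      nlinarith [mul_nonneg (Nat.cast_nonneg (α := ℚ) (m + 1)) (sub_nonneg.2 hk), Nat.cast_succ (R := ℚ) m]
    nlinarith [mul_le_mul_of_nonneg_right this (by positivity : (0 : ℚ) ≤ m + 1)]
  rw [Finset.sum_neg_distrib] at h2
  linarith

/-- if `p` is a polynomial whose values at positive integers `t`
count the lattice points of the `t`-th dilate of the hypersimplex `Δ_{k,d+1}` (the
points `x ∈ ℤ^{d+1}` with `0 ≤ x_j ≤ t` and `∑_j x_j = kt`), then the linear
coefficient of `p` is positive. -/
theorem stmt12 (d k : ℕ) (hd : 1 ≤ d) (hk1 : 1 ≤ k) (hk2 : k ≤ d)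
    (p : Polynomial ℚ)
    (hp : ∀ t : ℕ, 1 ≤ t → p.eval (t : ℚ) =
      ((((Finset.Icc (0 : Fin (d + 1) → ℤ) (fun _ => (t : ℤ))).filter
          (fun x => ∑ j, x j = (k : ℤ) * (t : ℤ))).card : ℚ))) :
    0 < p.coeff 1 := by
  have : p = hsQ d k := by
    refine Polynomial.eq_of_infinite_eval_eq _ _ ?_
    refine Set.Infinite.mono (s := (fun t : ℕ => (t : ℚ)) '' Set.Ici 1) ?_
      ((Set.Ici_infinite 1).image Nat.cast_injective.injOn)
    rintro _ ⟨t, ht, rfl⟩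
    have h := hs_count d t (k * t)
    push_cast at h
    show p.eval (t : ℚ) = (hsQ d k).eval (t : ℚ)
    rw [hp t ht, hsQ_eval d k t hk1 hk2 ht, h]
  rw [this]
  exact hsQ_coeff d k hk1 hk2
end

section
/- For n ≥ 1, let h(n) denote the sum, over all finite sequences (l_1,…,l_m) of positive integers with l_1 + ⋯ + l_m = n and each l_j equal to 1 or even, of the product ∏_j w(l_j), where w(1) = 1 and w(l) = l for even l. Then in the ring of formal power series ℚ[[z]], the identity (∑_{n≥1} h(n)·z^n)·(1 − z − 4z² + 2z³ + z⁴ − z⁵) = z + 2z² − 2z³ + z⁵ holds; in particular the generating function of h is the rational function z(z⁴ − 2z² + 2z + 1)/(1 − z − 4z² + 2z³ + z⁴ − z⁵) = z + 3z² + 5z³ + 15z⁴ + 29z⁵ + ⋯, so h(n) (the number of terms in the spider-diagram formula for the Berline–Vergne values on an (n−1)-dimensional braid fan) grows exponentially. -/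
open PowerSeries Finset

def wtt (l : ℕ) : ℚ := if l = 1 then 1 else if Even l then (l : ℚ) else 0

def FF (n : ℕ) : ℚ := ∑ c : Composition n, (c.blocks.map wtt).prod

lemma FF_zero : FF 0 = 1 := by
  unfold FF
  have h : ∀ c : Composition 0, c.blocks = [] := fun c => by
    rw [Composition.blocks_eq_nil]
  have : Fintype.card (Composition 0) = 1 := by simp [composition_card]
  simp [h, this]

lemma FF_succ (n : ℕ) : FF (n + 1) = ∑ p ∈ antidiagonal n, wtt (p.1 + 1) * FF p.2 := by
  unfold FF
  simp_rw [Finset.mul_sum]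
  rw [Finset.sum_sigma']
  symm
  refine Finset.sum_bij (fun x hx => (⟨(x.1.1 + 1) :: x.2.blocks, ?_, ?_⟩ : Composition (n + 1))) ?_ ?_ ?_ ?_
  · intro i hi
    rcases List.mem_cons.1 hi with rfl | hi
    · omega
    · exact x.2.blocks_pos hi
  · have := x.2.blocks_sum
    simp at hx
    simp [this]; omega
  · simp
  · rintro ⟨⟨a, b⟩, c⟩ h1 ⟨⟨a', b'⟩, c'⟩ h2 h
    simp at h1 h2 h
    obtain ⟨rfl, h⟩ := h
    obtain rfl : b = b' := by omega
    obtain rfl : c = c' := Composition.ext h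
    rfl
  · rintro ⟨l, hl, hs⟩ -
    cases l with
    | nil => simp at hs
    | cons a t =>
      have ha : 0 < a := hl (by simp)
      simp at hs
      refine ⟨⟨(a - 1, t.sum), ⟨t, fun hi => hl (List.mem_cons_of_mem _ hi), rfl⟩⟩, ?_, ?_⟩
      · simp; omega
      · apply Composition.ext
        simp; omega
  · simp

lemma FF_eq (n : ℕ) : FF n = ∑ c : Composition n,
      if ∀ l ∈ c.blocks, l = 1 ∨ Even l
      then (c.blocks.map (fun l => if l = 1 then (1 : ℚ) else (l : ℚ))).prod
      else 0 := by
  unfold FF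
  refine Finset.sum_congr rfl fun c _ => ?_
  split_ifs with h
  · congr 1
    rw [bind_pure_comp, List.map_eq_map, List.map_map]
    refine List.map_congr_left fun l hl => ?_
    have := h l hl
    simp only [wtt, Function.comp, Nat.cast_eq_one]
    grind
  · push Not at h
    obtain ⟨l, hl, h1, h2⟩ := h
    apply List.prod_eq_zero
    rw [List.mem_map]
    exact ⟨l, hl, by simp [wtt, h1, h2]⟩

lemma FF_ps : PowerSeries.mk FF = 1 + (X * PowerSeries.mk fun n => wtt (n + 1)) * PowerSeries.mk FF := by
  ext n
  cases n with
  | zero => simp [FF_zero]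
  | succ n =>
    rw [mul_assoc]
    rw [map_add, coeff_succ_X_mul]
    simp [coeff_mul, FF_succ, coeff_one]

lemma wtt_ps : (X * PowerSeries.mk fun n => wtt (n + 1)) * (1 - 2 * X ^ 2 + X ^ 4) =
    (X + 2 * X ^ 2 - 2 * X ^ 3 + X ^ 5 : PowerSeries ℚ) := by
  have : (PowerSeries.mk fun n => wtt (n + 1)) * (1 - 2 * X ^ 2 + X ^ 4) =
    (1 + 2 * X - 2 * X ^ 2 + X ^ 4 : PowerSeries ℚ) := by
    have e2 : (2 : PowerSeries ℚ) = C 2 := (map_ofNat C 2).symm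
    rw [mul_add, mul_sub, mul_one, mul_left_comm, e2]
    ext n
    simp only [map_add, map_sub, coeff_mul_X_pow', coeff_C_mul, coeff_mk, coeff_X_pow, coeff_X, coeff_one]
    rcases n with _ | _ | _ | _ | _ | n
    · simp [wtt]
    · simp [wtt]
    · simp [wtt]; decide
    · simp [wtt, show Even 4 from by decide]; norm_num
    · simp [wtt, show ¬ Even 5 from by decide, show ¬ Even 3 from by decide]
    · have : n + 5 - 2 = n + 3 := by omega
      have h4 : n + 5 - 4 = n + 1 := by omega
      simp [wtt, this, h4, Nat.even_add_one]
      by_cases h : Even n <;> simp [h, Nat.even_add, show ¬ Even 5 from by decide, show Even 6 from by decide, show Even 4 from by decide] <;> ring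
  rw [mul_assoc, this]; ring

theorem stmt14 (h : ℕ → ℚ)
    (hh : ∀ n : ℕ, 1 ≤ n → h n = ∑ c : Composition n,
      if ∀ l ∈ c.blocks, l = 1 ∨ Even l
      then (c.blocks.map (fun l => if l = 1 then (1 : ℚ) else (l : ℚ))).prod
      else 0) :
    (PowerSeries.mk fun n => if n = 0 then 0 else h n) *
        (1 - PowerSeries.X - 4 * PowerSeries.X ^ 2 + 2 * PowerSeries.X ^ 3 +
          PowerSeries.X ^ 4 - PowerSeries.X ^ 5) =
      (PowerSeries.X + 2 * PowerSeries.X ^ 2 - 2 * PowerSeries.X ^ 3 +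
        PowerSeries.X ^ 5 : PowerSeries ℚ) := by
  have e : (PowerSeries.mk fun n => if n = 0 then 0 else h n) = PowerSeries.mk FF - 1 := by
    ext n
    rcases n with _ | n
    · simp [FF_zero]
    · simp [coeff_one, FF_eq, hh]
  rw [e]
  have h1 := FF_ps
  have h2 := wtt_ps
  generalize (X * PowerSeries.mk fun n => wtt (n + 1)) = P at *
  generalize PowerSeries.mk FF = H at *
  linear_combination (1 - 2 * X ^ 2 + X ^ 4) * h1 + H * h2
end

section
/- Let d ≥ 1 and let S_• = (S_1 ⊊ ⋯ ⊊ S_k) be a k-chain in B̄. Then there exist rational numbers c(T_•), indexed by the chains T_• in B̄ that contain all of S_1,…,S_k, such that in A_d one has ∏_{i=1}^k x_{S_i}^{m_i} = ∑_{T_•} c(T_•)·x_{T_•} for any fixed exponents m_i ≥ 1 with ∑ m_i equal to the common length of the chains T_•; that is, every monomial supported on a chain admits a square-free expansion in A_d in terms of square-free monomials of longer chains refining S_•. -/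
open MvPolynomial

/-- The rational span of `I₁+I₂` and of the square-free monomials of length `n` refining `H`. -/
noncomputable def VV (d : ℕ) (H : Finset (Subs d)) (n : ℕ) : Submodule ℚ (Rd d) :=
  (Itot d).restrictScalars ℚ ⊔ Submodule.span ℚ (chainMon d ''
    {Ch : Finset (Subs d) | IsProperChain d Ch ∧ H ⊆ Ch ∧ Ch.card = n})

lemma VV_mono {d : ℕ} {H H' : Finset (Subs d)} (h : H ⊆ H') (n : ℕ) :
    VV d H' n ≤ VV d H n := by
  unfold VV
  refine sup_le_sup le_rfl (Submodule.span_mono (Set.image_mono ?_))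
  rintro Ch ⟨h1, h2, h3⟩
  exact ⟨h1, h.trans h2, h3⟩

lemma mem_VV_of_Itot {d : ℕ} {H : Finset (Subs d)} {n : ℕ} {p : Rd d} (h : p ∈ Itot d) :
    p ∈ VV d H n :=
  Submodule.mem_sup_left (S := (Itot d).restrictScalars ℚ) h

lemma exists_low {d : ℕ} {H : Finset (Subs d)} (hH : IsProperChain d H) {S : Subs d}
    (hS : S ∈ H) : ∃ a ∈ S, ∀ T ∈ H, T ⊂ S → a ∉ T := by
  by_cases hne : (H.filter (fun T => T ⊂ S)).Nonempty
  · obtain ⟨U, hU, hmax⟩ := Finset.exists_max_image _ Finset.card hne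
    simp only [Finset.mem_filter] at hU hmax
    obtain ⟨a, haS, haU⟩ := Finset.exists_of_ssubset hU.2
    refine ⟨a, haS, fun T hT hTS haT => ?_⟩
    rcases hH.2 T hT U hU.1 with h | h
    · exact haU (h haT)
    · have := Finset.eq_of_subset_of_card_le h (hmax T ⟨hT, hTS⟩)
      exact haU (this ▸ haT)
  · obtain ⟨a, ha⟩ := Finset.nonempty_iff_ne_empty.2 (hH.1 S hS).1
    refine ⟨a, ha, fun T hT hTS => (hne ⟨T, ?_⟩).elim⟩
    simp [hT, hTS]

lemma exists_high {d : ℕ} {H : Finset (Subs d)} (hH : IsProperChain d H) {S : Subs d}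
    (hS : S ∈ H) : ∃ b, b ∉ S ∧ ∀ T ∈ H, S ⊂ T → b ∈ T := by
  by_cases hne : (H.filter (fun T => S ⊂ T)).Nonempty
  · obtain ⟨U, hU, hmin⟩ := Finset.exists_min_image _ Finset.card hne
    simp only [Finset.mem_filter] at hU hmin
    obtain ⟨b, hbU, hbS⟩ := Finset.exists_of_ssubset hU.2
    refine ⟨b, hbS, fun T hT hTS => ?_⟩
    rcases hH.2 U hU.1 T hT with h | h
    · exact h hbU
    · have := Finset.eq_of_subset_of_card_le h (hmin T ⟨hT, hTS⟩)
      exact this ▸ hbU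
  · have h2 := (hH.1 S hS).2
    obtain ⟨b, hb⟩ : ∃ b, b ∉ S := by
      by_contra hcon
      push Not at hcon
      exact h2 (Finset.eq_univ_iff_forall.2 hcon)
    refine ⟨b, hb, fun T hT hTS => (hne ⟨T, ?_⟩).elim⟩
    simp [hT, hTS]

lemma incomp_mem {d : ℕ} {H : Finset (Subs d)} (hH : IsProperChain d H) {S T : Subs d}
    (hS : S ∈ H) (hT : isProper d T) (h1 : ¬ T ⊆ S) (h2 : ¬ S ⊆ T) (m : Subs d → ℕ)
    (hm : 1 ≤ m S) : (X T : Rd d) * ∏ U ∈ H, X U ^ m U ∈ Itot d := by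
  have h : (X T * X S : Rd d) ∈ Itot d :=
    Ideal.mem_sup_left (Ideal.subset_span ⟨T, S, hT, hH.1 S hS, h1, h2, rfl⟩)
  have hd : (X S : Rd d) ∣ ∏ U ∈ H, X U ^ m U :=
    (dvd_pow_self _ (by omega)).trans (Finset.dvd_prod_of_mem (fun U => (X U : Rd d) ^ m U) hS)
  exact Ideal.mem_of_dvd _ (mul_dvd_mul_left _ hd) h

lemma ell_sub {d : ℕ} (a b : Fin (d + 1)) : ell d a - ell d b =
    ∑ T ∈ Finset.univ.filter (fun T : Subs d => isProper d T ∧ a ∈ T ∧ b ∉ T), X T -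
    ∑ T ∈ Finset.univ.filter (fun T : Subs d => isProper d T ∧ b ∈ T ∧ a ∉ T), X T := by
  unfold ell
  simp only [Finset.sum_filter, ← Finset.sum_sub_distrib]
  refine Finset.sum_congr rfl fun T _ => ?_
  by_cases h : isProper d T <;> by_cases ha : a ∈ T <;> by_cases hb : b ∈ T <;> simp [h, ha, hb]

lemma main_aux {d : ℕ} (e : ℕ) : ∀ (H : Finset (Subs d)) (m : Subs d → ℕ), IsProperChain d H →
    (∀ T ∈ H, 1 ≤ m T) → ∑ T ∈ H, m T = H.card + e →
    (∏ T ∈ H, X T ^ m T : Rd d) ∈ VV d H (H.card + e) := by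
  induction e with
  | zero =>
    intro H m hH hm hsum
    have h1 : ∀ T ∈ H, 1 = m T := by
      rw [← Finset.sum_eq_sum_iff_of_le hm]
      simp [hsum]
    refine Submodule.mem_sup_right (Submodule.subset_span ⟨H, ⟨hH, subset_rfl, rfl⟩, ?_⟩)
    unfold chainMon
    refine Finset.prod_congr rfl fun T hT => ?_
    rw [← h1 T hT, pow_one]
  | succ e ih =>
    intro H m hH hm hsum
    obtain ⟨S, hS, hmS⟩ : ∃ S ∈ H, 1 < m S := by
      apply Finset.exists_lt_of_sum_lt
      simp [hsum]
    obtain ⟨a, haS, ha⟩ := exists_low hH hS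
    obtain ⟨b, hbS, hb⟩ := exists_high hH hS
    set m' : Subs d → ℕ := Function.update m S (m S - 1) with hm'
    have hm'S : m' S = m S - 1 := by simp [hm']
    have hm'ne : ∀ T, T ≠ S → m' T = m T := fun T hT => by simp [hm', hT]
    have hm'1 : ∀ T ∈ H, 1 ≤ m' T := by
      intro T hT
      by_cases h : T = S
      · subst h; omega
      · rw [hm'ne T h]; exact hm T hT
    have hsum' : ∑ T ∈ H, m' T = H.card + e := by
      have e1 := Finset.add_sum_erase H m hS
      have e2 := Finset.add_sum_erase H m' hS
      have e3 : ∑ T ∈ H.erase S, m' T = ∑ T ∈ H.erase S, m T :=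
        Finset.sum_congr rfl fun T hT => hm'ne T (Finset.ne_of_mem_erase hT)
      omega
    set M' : Rd d := ∏ T ∈ H, X T ^ m' T with hM'
    have hM : (∏ T ∈ H, X T ^ m T : Rd d) = X S * M' := by
      rw [hM', ← Finset.mul_prod_erase H _ hS, ← Finset.mul_prod_erase H (fun T => X T ^ m' T) hS,
        ← mul_assoc, ← pow_succ', hm'S, Nat.sub_add_cancel hmS.le]
      congr 1
      exact Finset.prod_congr rfl fun T hT => by rw [hm'ne T (Finset.ne_of_mem_erase hT)]
    -- the relation
    have hrel : (ell d a - ell d b) * M' ∈ VV d H (H.card + (e + 1)) :=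
      mem_VV_of_Itot (Ideal.mul_mem_right _ _
        (Ideal.mem_sup_right (Ideal.subset_span ⟨a, b, rfl⟩)))
    have hB : (∑ T ∈ Finset.univ.filter (fun T : Subs d => isProper d T ∧ b ∈ T ∧ a ∉ T), X T)
        * M' ∈ VV d H (H.card + (e + 1)) := by
      rw [Finset.sum_mul]
      refine Submodule.sum_mem _ fun T hT => ?_
      simp only [Finset.mem_filter, Finset.mem_univ, true_and] at hT
      exact mem_VV_of_Itot (incomp_mem hH hS hT.1 (fun h => hbS (h hT.2.1))
        (fun h => hT.2.2 (h haS)) m' (hm'1 S hS))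
    have hA : (∑ T ∈ (Finset.univ.filter
        (fun T : Subs d => isProper d T ∧ a ∈ T ∧ b ∉ T)).erase S, X T)
        * M' ∈ VV d H (H.card + (e + 1)) := by
      rw [Finset.sum_mul]
      refine Submodule.sum_mem _ fun T hT => ?_
      simp only [Finset.mem_erase, Finset.mem_filter, Finset.mem_univ, true_and] at hT
      obtain ⟨hTS, hTp, haT, hbT⟩ := hT
      by_cases hcomp : ∀ U ∈ H, T ⊆ U ∨ U ⊆ T
      · have hTH : T ∉ H := by
          intro hTH
          rcases hcomp S hS with h | h
          · exact ha T hTH (h.ssubset_of_ne hTS) haT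
          · exact hbT (hb T hTH (h.ssubset_of_ne (Ne.symm hTS)))
        have hchain : IsProperChain d (insert T H) := by
          refine ⟨?_, ?_⟩
          · intro U hU
            rcases Finset.mem_insert.1 hU with rfl | hU
            · exact hTp
            · exact hH.1 U hU
          · intro U hU W hW
            rcases Finset.mem_insert.1 hU with rfl | hU'
            · rcases Finset.mem_insert.1 hW with rfl | hW
              · exact Or.inl subset_rfl
              · exact hcomp W hW
            · rcases Finset.mem_insert.1 hW with rfl | hW
              · exact (hcomp U hU').symm
              · exact hH.2 U hU' W hW
        set m'' : Subs d → ℕ := Function.update m' T 1 with hm''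
        have hT1 : m'' T = 1 := by simp [hm'']
        have hne : ∀ U ∈ H, m'' U = m' U := fun U hU => by
          have : U ≠ T := fun h => hTH (h ▸ hU)
          simp [hm'', this]
        have := ih (insert T H) m'' hchain ?_ ?_
        · rw [Finset.prod_insert hTH, hT1, pow_one,
            Finset.prod_congr rfl (fun U hU => by rw [hne U hU]),
            Finset.card_insert_of_notMem hTH] at this
          have h2 := VV_mono (Finset.subset_insert T H) _ this
          rw [show H.card + (e + 1) = H.card + 1 + e by omega]
          exact h2
        · intro U hU
          rcases Finset.mem_insert.1 hU with rfl | hU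
          · omega
          · rw [hne U hU]; exact hm'1 U hU
        · rw [Finset.sum_insert hTH, hT1, Finset.sum_congr rfl hne, hsum',
            Finset.card_insert_of_notMem hTH]
          omega
      · push Not at hcomp
        obtain ⟨U, hU, h1, h2⟩ := hcomp
        exact mem_VV_of_Itot (incomp_mem hH hU hTp h1 h2 m' (hm'1 U hU))
    have hSmem : S ∈ Finset.univ.filter
        (fun T : Subs d => isProper d T ∧ a ∈ T ∧ b ∉ T) := by
      simp [hH.1 S hS, haS, hbS]
    rw [ell_sub, ← Finset.add_sum_erase _ _ hSmem] at hrel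
    rw [hM]
    have := Submodule.add_mem _ (Submodule.sub_mem _ hrel hA) hB
    convert this using 1
    ring

/-- every monomial `∏_i x_{S_i}^{m_i}` supported on a chain
`S₁ ⊊ ⋯ ⊊ S_k` in `B̄` admits a square-free expansion in `A_d`: there are rational
coefficients `c(T_•)`, indexed by the chains `T_•` in `B̄` of length `∑ m_i`
containing all the `S_i`, with `∏_i x_{S_i}^{m_i} = ∑_{T_•} c(T_•)·x_{T_•}` in `A_d`. -/
theorem stmt15 (d k : ℕ) (hd : 1 ≤ d)
    (S : Fin k → Subs d) (hproper : ∀ i, isProper d (S i)) (hmono : StrictMono S)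
    (m : Fin k → ℕ) (hm : ∀ i, 1 ≤ m i) :
    ∃ c : Finset (Subs d) → ℚ,
      (∏ i, X (S i) ^ m i : Rd d) -
        ∑ Ch ∈ Finset.univ.filter (fun Ch : Finset (Subs d) =>
            IsProperChain d Ch ∧ (∀ i, S i ∈ Ch) ∧ Ch.card = ∑ i, m i),
          C (c Ch) * chainMon d Ch ∈ Itot d := by
  classical
  have hinj : Function.Injective S := hmono.injective
  set H : Finset (Subs d) := Finset.univ.image S with hHdef
  have hchain : IsProperChain d H := by
    refine ⟨?_, ?_⟩
    · intro T hT
      obtain ⟨i, -, rfl⟩ := Finset.mem_image.1 hT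
      exact hproper i
    · intro T hT U hU
      obtain ⟨i, -, rfl⟩ := Finset.mem_image.1 hT
      obtain ⟨j, -, rfl⟩ := Finset.mem_image.1 hU
      rcases le_total i j with h | h
      · exact Or.inl (hmono.monotone h)
      · exact Or.inr (hmono.monotone h)
  set mm : Subs d → ℕ := Function.extend S m 0 with hmm
  have hmmS : ∀ i, mm (S i) = m i := fun i => hinj.extend_apply _ _ _
  have hprod : (∏ T ∈ H, X T ^ mm T : Rd d) = ∏ i, X (S i) ^ m i := by
    rw [hHdef, Finset.prod_image (fun _ _ _ _ h => hinj h)]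
    simp only [hmmS]
  have hsum : ∑ T ∈ H, mm T = ∑ i, m i := by
    rw [hHdef, Finset.sum_image (fun _ _ _ _ h => hinj h)]
    simp only [hmmS]
  have hmm1 : ∀ T ∈ H, 1 ≤ mm T := by
    intro T hT
    obtain ⟨i, -, rfl⟩ := Finset.mem_image.1 hT
    rw [hmmS]; exact hm i
  have hle : H.card ≤ ∑ T ∈ H, mm T := by
    simpa using Finset.sum_le_sum hmm1
  obtain ⟨e, he⟩ := Nat.exists_eq_add_of_le hle
  have key := main_aux e H mm hchain hmm1 he
  rw [hprod, ← he, hsum] at key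
  obtain ⟨p, hp, q, hq, hpq⟩ := Submodule.mem_sup.1 key
  have hset : {Ch : Finset (Subs d) | IsProperChain d Ch ∧ H ⊆ Ch ∧ Ch.card = ∑ i, m i} =
      ↑(Finset.univ.filter (fun Ch : Finset (Subs d) =>
            IsProperChain d Ch ∧ (∀ i, S i ∈ Ch) ∧ Ch.card = ∑ i, m i)) := by
    ext Ch
    simp [hHdef, Finset.image_subset_iff]
  rw [hset, Submodule.mem_span_image_finset_iff_exists_fun] at hq
  obtain ⟨c, hc⟩ := hq
  refine ⟨fun Ch => if h : Ch ∈ Finset.univ.filter (fun Ch : Finset (Subs d) =>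
            IsProperChain d Ch ∧ (∀ i, S i ∈ Ch) ∧ Ch.card = ∑ i, m i) then c ⟨Ch, h⟩ else 0, ?_⟩
  simp only [← MvPolynomial.smul_eq_C_mul]
  rw [← Finset.sum_coe_sort]
  simp only [Finset.coe_mem, dite_true, Subtype.coe_eta]
  rw [hc, ← hpq, add_sub_cancel_right]
  exact hp
end
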